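/- Let θ ∈ (0,1), let β be a nonnegative integer and m = 2^β, and let δ = ρ/(2τ) where ρ, τ are positive integers with ρ ≤ τ. Then the average code-length of the modified Rice–Golomb code satisfies ∫_ℝ ℓ(ε)·f_θ(ε) dε = 1 + β + (1/2)·(θ^(m/2)/(1 − θ^(m/2)))·(θ^δ + θ^(−δ)). -/

import Mathlib

open MeasureTheory

lemma abs_eqOn_Ioi {b : ℝ} (hb : 0 ≤ b) (c : ℝ) :
    Set.EqOn (fun x : ℝ => Real.exp (-c * x)) (fun x => Real.exp (-c * |x|)) (Set.Ioi b) :=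
  fun x hx => by
    rw [Set.mem_Ioi] at hx
    simp only [abs_of_pos (hb.trans_lt hx)]

lemma abs_eqOn_Iic {a : ℝ} (ha : 0 ≤ a) (c : ℝ) :
    Set.EqOn (fun x : ℝ => Real.exp (c * x)) (fun x => Real.exp (-c * |x|)) (Set.Iic (-a)) :=
  fun x hx => by
    rw [Set.mem_Iic] at hx
    simp only [abs_of_nonpos (by linarith : x ≤ 0), neg_mul_neg]

lemma integrable_exp_neg_mul_abs {c : ℝ} (hc : 0 < c) :
    Integrable (fun x : ℝ => Real.exp (-c * |x|)) := by
  have h1 := (integrableOn_exp_mul_Ioi (neg_lt_zero.2 hc) 0).congr_fun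
    (abs_eqOn_Ioi le_rfl c) measurableSet_Ioi
  have h2 := (integrableOn_exp_mul_Iic hc (-0)).congr_fun
    (abs_eqOn_Iic le_rfl c) measurableSet_Iic
  rw [neg_zero] at h2
  rw [← integrableOn_univ, ← Set.Iic_union_Ioi (a := (0 : ℝ))]
  exact h2.union h1

lemma integral_exp_neg_mul_abs_tails {c a b : ℝ} (hc : 0 < c) (ha : 0 ≤ a) (hb : 0 ≤ b) :
    ∫ x in Set.Iic (-a) ∪ Set.Ioi b, Real.exp (-c * |x|)
      = (Real.exp (-c * a) + Real.exp (-c * b)) / c := by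
  have hint := integrable_exp_neg_mul_abs hc
  rw [setIntegral_union (Set.Iic_disjoint_Ioi (by linarith)) measurableSet_Ioi
      hint.integrableOn hint.integrableOn,
    ← setIntegral_congr_fun measurableSet_Ioi (abs_eqOn_Ioi hb c),
    ← setIntegral_congr_fun measurableSet_Iic (abs_eqOn_Iic ha c),
    integral_exp_mul_Ioi (neg_lt_zero.2 hc), integral_exp_mul_Iic hc, mul_neg, neg_mul]
  field_simp

lemma integral_exp_neg_mul_abs {c : ℝ} (hc : 0 < c) :
    ∫ x : ℝ, Real.exp (-c * |x|) = 2 / c := by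
  have h := integral_exp_neg_mul_abs_tails hc le_rfl le_rfl
  rw [neg_zero, Set.Iic_union_Ioi, setIntegral_univ] at h
  rw [h]
  norm_num

lemma setIntegral_exp_neg_mul_abs_shift {c d t : ℝ} (hc : 0 < c) (hd : |d| ≤ t) :
    ∫ x in {x : ℝ | t ≤ |x + d|}, Real.exp (-c * |x|)
      = Real.exp (-c * t) * (Real.exp (-c * d) + Real.exp (c * d)) / c := by
  obtain ⟨h1, h2⟩ := abs_le.1 hd
  have hset : {x : ℝ | t ≤ |x + d|} = Set.Iic (-(t + d)) ∪ Set.Ici (t - d) := by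
    ext x
    simp only [Set.mem_ofPred_eq, Set.mem_union, Set.mem_Iic, Set.mem_Ici, le_abs]
    constructor
    · rintro (h | h)
      · right; linarith
      · left; linarith
    · rintro (h | h)
      · right; linarith
      · left; linarith
  rw [hset, setIntegral_congr_set ((ae_eq_refl _).union Ioi_ae_eq_Ici.symm),
    integral_exp_neg_mul_abs_tails hc (by linarith) (by linarith),
    mul_add (Real.exp _), ← Real.exp_add, ← Real.exp_add]
  ring_nf

lemma hasSum_indicator_floor {y : ℝ} (hy : 0 ≤ y) (a : ℝ) :
    HasSum (fun k : ℕ => if (k : ℝ) + 1 ≤ y then a else 0) (⌊y⌋ * a) := by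
  have hmem (k : ℕ) : (k : ℝ) + 1 ≤ y ↔ k ∈ Finset.range ⌊y⌋₊ := by
    rw [Finset.mem_range, ← Nat.succ_le_iff, Nat.le_floor_iff hy, Nat.cast_succ]
  have hsum : ∑ k ∈ Finset.range ⌊y⌋₊, (if (k : ℝ) + 1 ≤ y then a else 0) = ⌊y⌋ * a := by
    rw [Finset.sum_congr rfl fun k hk => if_pos ((hmem k).2 hk), Finset.sum_const,
      Finset.card_range, nsmul_eq_mul, natCast_floor_eq_intCast_floor hy]
  rw [← hsum]
  exact hasSum_sum_of_ne_finset_zero fun k hk => if_neg (mt (hmem k).1 hk)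

lemma integral_add_floor_mul_exp_neg_mul_abs {c d h : ℝ} (B : ℝ) (hc : 0 < c) (hh : 0 < h)
    (hd : |d| ≤ h) :
    ∫ x : ℝ, (B + ⌊|x + d| / h⌋) * Real.exp (-c * |x|)
      = (2 * B + Real.exp (-c * h) / (1 - Real.exp (-c * h)) *
          (Real.exp (-c * d) + Real.exp (c * d))) / c := by
  set g : ℝ → ℝ := fun x => Real.exp (-c * |x|) with hg
  have hint : Integrable g := integrable_exp_neg_mul_abs hc
  set S : ℕ → Set ℝ := fun k => {x | ((k : ℝ) + 1) * h ≤ |x + d|} with hS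
  have hSm (k : ℕ) : MeasurableSet (S k) := measurableSet_le (by fun_prop) (by fun_prop)
  have hSi (k : ℕ) : ∫ x, (S k).indicator g x = Real.exp (-c * h) ^ k *
      (Real.exp (-c * h) * (Real.exp (-c * d) + Real.exp (c * d)) / c) := by
    have hk : h ≤ ((k : ℝ) + 1) * h := by
      nlinarith [(Nat.cast_nonneg k : (0 : ℝ) ≤ k)]
    rw [integral_indicator (hSm k), hS, hg,
      setIntegral_exp_neg_mul_abs_shift hc (hd.trans hk), ← Real.exp_nat_mul]
    rw [show -c * (((k : ℝ) + 1) * h) = k * (-c * h) + -c * h by ring, Real.exp_add]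
    ring
  have hq : Real.exp (-c * h) < 1 := by
    rw [← Real.exp_zero]
    exact Real.exp_lt_exp.2 (by nlinarith)
  have hgeom := (hasSum_geometric_of_lt_one (Real.exp_pos (-c * h)).le hq).mul_right
    (Real.exp (-c * h) * (Real.exp (-c * d) + Real.exp (c * d)) / c)
  rw [← funext hSi] at hgeom
  let F : ℕ → ℝ → ℝ := fun i => i.casesOn (fun x => B * g x) fun k => (S k).indicator g
  have hF (i : ℕ) : Integrable (F i) := by
    cases i with
    | zero => exact hint.const_mul B
    | succ k => exact hint.indicator (hSm k)
  have hnorm (k : ℕ) : (fun x => ‖F (k + 1) x‖) = (S k).indicator g := funext fun x =>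
    Real.norm_of_nonneg (Set.indicator_nonneg (fun y _ => (Real.exp_pos _).le) x)
  have hFn : Summable fun i => ∫ x, ‖F i x‖ := by
    rw [← summable_nat_add_iff 1]
    simp only [hnorm]
    exact hgeom.summable
  have hpt (x : ℝ) : ∑' i, F i x = (B + ⌊|x + d| / h⌋) * g x := by
    have hfl := hasSum_indicator_floor (y := |x + d| / h) (by positivity) (g x)
    simp only [le_div_iff₀ hh] at hfl
    rw [add_mul]
    exact (HasSum.zero_add (f := fun i => F i x) hfl).tsum_eq
  have hsum := hasSum_integral_of_summable_integral_norm hF hFn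
  simp only [hpt] at hsum
  rw [hsum.unique (HasSum.zero_add (f := fun i => ∫ x, F i x) hgeom)]
  change (∫ x, B * g x) + _ = _
  rw [integral_const_mul, hg, integral_exp_neg_mul_abs hc]
  ring

/-- average code-length of the modified Rice–Golomb code when `m = 2^β`. -/
theorem avg_code_length_pow_two (θ : ℝ) (hθ : θ ∈ Set.Ioo (0:ℝ) 1)
    (β : ℕ) (ρ τ : ℕ) (hρ : 0 < ρ) (hτ : 0 < τ) (hρτ : ρ ≤ τ)
    (m : ℕ) (hm : m = 2 ^ β) (δ : ℝ) (hδ : δ = (ρ : ℝ) / (2 * τ)) :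
    ∫ ε : ℝ, ((1 + (β : ℝ) + (⌊2 * |ε + δ| / (m : ℝ)⌋ : ℝ)) *
        ((-Real.log θ / 2) * θ ^ |ε|))
      = 1 + (β : ℝ) +
        (1/2) * (θ ^ ((m : ℝ)/2) / (1 - θ ^ ((m : ℝ)/2))) * (θ ^ δ + θ ^ (-δ)) := by
  obtain ⟨h0, h1⟩ := hθ
  have hc : 0 < -Real.log θ := neg_pos.2 (Real.log_neg h0 h1)
  have hm1 : (1 : ℝ) ≤ m := by
    rw [hm]
    exact_mod_cast Nat.one_le_two_pow
  have hτ' : (0 : ℝ) < τ := Nat.cast_pos.2 hτ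
  have hδ0 : 0 ≤ δ := by rw [hδ]; positivity
  have hδ1 : δ ≤ 1 / 2 := by
    rw [hδ, div_le_div_iff₀ (by positivity) two_pos]
    have : (ρ : ℝ) ≤ τ := Nat.cast_le.2 hρτ
    linarith
  have key := integral_add_floor_mul_exp_neg_mul_abs (d := δ) (h := m / 2) (1 + β) hc
    (by linarith) (by rw [abs_of_nonneg hδ0]; linarith)
  simp only [neg_neg] at key
  simp only [Real.rpow_def_of_pos h0]
  have hfun (x : ℝ) : (1 + (β : ℝ) + (⌊2 * |x + δ| / (m : ℝ)⌋ : ℝ)) *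
      ((-Real.log θ / 2) * Real.exp (Real.log θ * |x|)) = (-Real.log θ / 2) *
      ((1 + (β : ℝ) + (⌊|x + δ| / ((m : ℝ) / 2)⌋ : ℝ)) * Real.exp (Real.log θ * |x|)) := by
    rw [show |x + δ| / ((m : ℝ) / 2) = 2 * |x + δ| / m by field_simp]
    ring
  simp only [hfun]
  rw [integral_const_mul, key, neg_mul, mul_neg]
  have hlog : Real.log θ ≠ 0 := (Real.log_neg h0 h1).ne
  generalize Real.exp (Real.log θ * (↑m / 2)) / (1 - Real.exp (Real.log θ * (↑m / 2))) = A
  field_simp
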